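/- arXiv:1710.11373 — 2 statements merged into one kernel-verified Lean document; each statement's English description precedes it below -/
import Mathlib

section
/- Let ρ be a bipartite density matrix on nA × nB. Then the one-sided discord is bounded above by the symmetric discord: Θ^{A|B}(ρ) ≤ Θ(ρ). -/
open Matrix
open Kronecker
open scoped ComplexOrder

/-- Von Neumann entropy of a matrix (defined via its eigenvalues when it is Hermitian). -/
noncomputable def vN {n : Type*} [Fintype n] [DecidableEq n] (ρ : Matrix n n ℂ) : ℝ :=
  letI := Classical.propDecidable ρ.IsHermitian
  if h : ρ.IsHermitian then ∑ i, Real.negMulLog (h.eigenvalues i) else 0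

/-- Full dephasing in the standard basis. -/
noncomputable def deph {n : Type*} [Fintype n] [DecidableEq n] (ρ : Matrix n n ℂ) :
    Matrix n n ℂ := Matrix.diagonal fun i => ρ i i

/-- Relative entropy of coherence in the standard basis. -/
noncomputable def coh {n : Type*} [Fintype n] [DecidableEq n] (ρ : Matrix n n ℂ) : ℝ :=
  vN (deph ρ) - vN ρ

/-- Partial dephasing on the first (A) subsystem of a bipartite state. -/
noncomputable def dephA {nA nB : Type*} [Fintype nA] [DecidableEq nA]
    [Fintype nB] [DecidableEq nB] (ρ : Matrix (nA × nB) (nA × nB) ℂ) :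
    Matrix (nA × nB) (nA × nB) ℂ :=
  Matrix.of fun p q => if p.1 = q.1 then ρ p q else 0

/-- Reduced state on subsystem A. -/
noncomputable def redA {nA nB : Type*} [Fintype nA] [DecidableEq nA]
    [Fintype nB] [DecidableEq nB] (ρ : Matrix (nA × nB) (nA × nB) ℂ) : Matrix nA nA ℂ :=
  Matrix.of fun a a' => ∑ b, ρ (a, b) (a', b)

/-- Reduced state on subsystem B. -/
noncomputable def redB {nA nB : Type*} [Fintype nA] [DecidableEq nA]
    [Fintype nB] [DecidableEq nB] (ρ : Matrix (nA × nB) (nA × nB) ℂ) : Matrix nB nB ℂ :=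
  Matrix.of fun b b' => ∑ a, ρ (a, b) (a, b')

/-- Quantum mutual information of a bipartite state. -/
noncomputable def mi {nA nB : Type*} [Fintype nA] [DecidableEq nA]
    [Fintype nB] [DecidableEq nB] (ρ : Matrix (nA × nB) (nA × nB) ℂ) : ℝ :=
  vN (redA ρ) + vN (redB ρ) - vN ρ

/-- The action `(U ⊗ 1) ρ (U ⊗ 1)∗` of a local unitary on the A subsystem. -/
noncomputable def conjA {nA nB : Type*} [Fintype nA] [DecidableEq nA]
    [Fintype nB] [DecidableEq nB] (U : Matrix nA nA ℂ)
    (ρ : Matrix (nA × nB) (nA × nB) ℂ) : Matrix (nA × nB) (nA × nB) ℂ :=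
  (U ⊗ₖ (1 : Matrix nB nB ℂ)) * ρ * (U ⊗ₖ (1 : Matrix nB nB ℂ))ᴴ

/-! ### Entropy through the characteristic polynomial -/

theorem vN_eq_sum_roots {n : Type*} [Fintype n] [DecidableEq n] {M : Matrix n n ℂ}
    (hM : M.IsHermitian) :
    vN M = (M.charpoly.roots.map fun z => Real.negMulLog z.re).sum := by
  rw [vN, dif_pos hM, hM.roots_charpoly_eq_eigenvalues, Multiset.map_map]
  simp [Function.comp_def]

theorem vN_diagonal {n : Type*} [Fintype n] [DecidableEq n] (d : n → ℝ) :
    vN (diagonal fun i => (d i : ℂ)) = ∑ i, Real.negMulLog (d i) := by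
  have hd : (diagonal fun i => (d i : ℂ)).IsHermitian := by
    rw [isHermitian_diagonal_iff]
    intro i
    simp [isSelfAdjoint_iff]
  rw [vN_eq_sum_roots hd, charpoly_diagonal, Polynomial.roots_prod]
  · simp
  · simp [Finset.prod_ne_zero_iff, Polynomial.X_sub_C_ne_zero]

theorem vN_unitary_conj {n : Type*} [Fintype n] [DecidableEq n] {M V : Matrix n n ℂ}
    (hM : M.IsHermitian) (hV : Vᴴ * V = 1) : vN (V * M * Vᴴ) = vN M := by
  rw [vN_eq_sum_roots (isHermitian_mul_mul_conjTranspose V hM), vN_eq_sum_roots hM,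
    charpoly_mul_comm, ← mul_assoc, hV, one_mul]

theorem charpoly_blockDiagonal {m o : Type*} [Fintype m] [DecidableEq m] [Fintype o]
    [DecidableEq o] (M : o → Matrix m m ℂ) :
    (blockDiagonal M).charpoly = ∏ k, (M k).charpoly := by
  have h : charmatrix (blockDiagonal M) = blockDiagonal fun k => charmatrix (M k) := by
    ext ⟨i, k⟩ ⟨j, l⟩
    by_cases hkl : k = l
    · subst hkl
      by_cases hij : i = j <;> simp [charmatrix, blockDiagonal_apply, hij]
    · simp [charmatrix, blockDiagonal_apply, hkl]
  simp [charpoly, h]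

theorem vN_nonneg {n : Type*} [Fintype n] [DecidableEq n] {M : Matrix n n ℂ}
    (hM : M.PosSemidef) (htr : M.trace = 1) : 0 ≤ vN M := by
  rw [vN, dif_pos hM.isHermitian]
  have hsum : ∑ i, hM.isHermitian.eigenvalues i = 1 := by
    have := hM.isHermitian.trace_eq_sum_eigenvalues
    rw [htr, ← Complex.ofReal_one] at this
    exact Complex.ofReal_injective (by simpa using this.symm)
  refine Finset.sum_nonneg fun i _ => Real.negMulLog_nonneg (hM.eigenvalues_nonneg i) ?_
  rw [← hsum]
  exact Finset.single_le_sum (fun j _ => hM.eigenvalues_nonneg j) (Finset.mem_univ i)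

theorem vN_le_card {n : Type*} [Fintype n] [DecidableEq n] {M : Matrix n n ℂ}
    (hM : M.PosSemidef) : vN M ≤ Fintype.card n := by
  rw [vN, dif_pos hM.isHermitian, Fintype.card, Finset.cast_card]
  refine Finset.sum_le_sum fun i _ => ?_
  have := Real.negMulLog_le_one_sub_self (hM.eigenvalues_nonneg i)
  linarith [hM.eigenvalues_nonneg i]

/-! ### Convexity of the relative entropy of coherence -/

theorem Matrix.PosSemidef.coe_re_diag {n : Type*} {M : Matrix n n ℂ}
    (hM : M.PosSemidef) (i : n) : ((M i i).re : ℂ) = M i i :=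
  hM.isHermitian.coe_re_apply_self i

theorem vN_deph {n : Type*} [Fintype n] [DecidableEq n] {M : Matrix n n ℂ}
    (hM : M.PosSemidef) : vN (deph M) = ∑ i, Real.negMulLog (M i i).re := by
  rw [← vN_diagonal]
  simp only [deph, hM.coe_re_diag]

/-- The function `t ↦ ∑ |W k i|² p i log (q k + t p i)`. It interpolates between the negative
entropies of the diagonal `q` (at `t = 0`) and of the spectrum `p` (as `t → ∞`) of a matrix with
eigenvectors `W`. -/
noncomputable def logProfile {n : Type*} [Fintype n] (W : Matrix n n ℂ) (p q : n → ℝ) (t : ℝ) :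
    ℝ :=
  ∑ k, ∑ i, ‖W k i‖ ^ 2 * (p i * Real.log (q k + t * p i))

/-- The derivative of `logProfile W p q`. -/
noncomputable def logProfileDeriv {n : Type*} [Fintype n] (W : Matrix n n ℂ) (p q : n → ℝ)
    (t : ℝ) : ℝ :=
  ∑ k, ∑ i, ‖W k i‖ ^ 2 * (p i ^ 2 / (q k + t * p i))

theorem hasDerivAt_logProfile {n : Type*} [Fintype n] (W : Matrix n n ℂ) {p q : n → ℝ}
    (hp : ∀ i, 0 ≤ p i) (hq : ∀ k, 0 ≤ q k) {t : ℝ} (ht : 0 < t) :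
    HasDerivAt (logProfile W p q) (logProfileDeriv W p q t) t := by
  refine HasDerivAt.fun_sum fun k _ => HasDerivAt.fun_sum fun i _ => HasDerivAt.const_mul _ ?_
  rcases (hp i).eq_or_lt with h | h
  · simpa [← h] using hasDerivAt_const t (0 : ℝ)
  · have h0 : q k + t * p i ≠ 0 := (add_pos_of_nonneg_of_pos (hq k) (mul_pos ht h)).ne'
    have := (((hasDerivAt_id' t).mul_const (p i)).const_add (q k)).log h0 |>.const_mul (p i)
    convert this using 1
    ring

theorem continuousOn_logProfile {n : Type*} [Fintype n] {W : Matrix n n ℂ} {p q : n → ℝ}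
    (hp : ∀ i, 0 ≤ p i) (hq : ∀ k i, ‖W k i‖ ^ 2 * p i ≤ q k) :
    ContinuousOn (logProfile W p q) (Set.Ici 0) := by
  refine continuousOn_finsetSum _ fun k _ => continuousOn_finsetSum _ fun i _ => ?_
  rcases (mul_nonneg (sq_nonneg ‖W k i‖) (hp i)).eq_or_lt with h | h
  · simp only [← mul_assoc, ← h, zero_mul]
    exact continuousOn_const
  · refine continuousOn_const.mul (continuousOn_const.mul (ContinuousOn.log (by fun_prop) ?_))
    intro t ht
    exact (add_pos_of_pos_of_nonneg (h.trans_le (hq k i)) (mul_nonneg ht (hp i))).ne'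

theorem tendsto_logProfile {n : Type*} [Fintype n] (W : Matrix n n ℂ) {p q : n → ℝ}
    (hp : ∀ i, 0 ≤ p i) (hq : ∀ k, 0 ≤ q k) :
    Filter.Tendsto (fun t => logProfile W p q t - (∑ k, ∑ i, ‖W k i‖ ^ 2 * p i) * Real.log t)
      Filter.atTop (nhds (∑ k, ∑ i, ‖W k i‖ ^ 2 * (p i * Real.log (p i)))) := by
  simp only [logProfile, Finset.sum_mul, ← Finset.sum_sub_distrib]
  refine tendsto_finsetSum _ fun k _ => tendsto_finsetSum _ fun i _ => ?_
  rcases (hp i).eq_or_lt with h | h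
  · simp [← h]
  · have hlim : Filter.Tendsto (fun t : ℝ => q k / t + p i) Filter.atTop (nhds (p i)) := by
      simpa using (tendsto_const_nhds (x := q k)).div_atTop Filter.tendsto_id |>.add_const (p i)
    refine (((hlim.log h.ne').const_mul (p i)).const_mul (‖W k i‖ ^ 2)).congr' ?_
    filter_upwards [Filter.eventually_gt_atTop 0] with t ht
    have h1 : q k / t + p i = (q k + t * p i) / t := by field_simp
    have h0 : q k + t * p i ≠ 0 := (add_pos_of_nonneg_of_pos (hq k) (mul_pos ht h)).ne'
    rw [h1, Real.log_div h0 ht.ne']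
    ring

/-- For each `Y`, an additive functional of `ρ`; its supremum over `Y` is `logProfileDeriv`. -/
noncomputable def cohForm {n : Type*} [Fintype n] [DecidableEq n] (s : ℝ) (Y ρ : Matrix n n ℂ) :
    ℝ :=
  2 * (Yᴴ * ρ).trace.re - (Yᴴ * deph ρ * Y).trace.re - s * (Y * ρ * Yᴴ).trace.re

theorem deph_sum {n ι : Type*} [Fintype n] [DecidableEq n] [Fintype ι] (τ : ι → Matrix n n ℂ) :
    deph (∑ a, τ a) = ∑ a, deph (τ a) := by
  ext i j
  by_cases h : i = j <;> simp [deph, Matrix.sum_apply, h]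

theorem cohForm_sum {n ι : Type*} [Fintype n] [DecidableEq n] [Fintype ι] (s : ℝ)
    (Y : Matrix n n ℂ) (τ : ι → Matrix n n ℂ) :
    cohForm s Y (∑ a, τ a) = ∑ a, cohForm s Y (τ a) := by
  simp only [cohForm, deph_sum, Matrix.sum_mul, trace_sum, Complex.re_sum,
    Finset.sum_sub_distrib, Finset.mul_sum]

theorem cohForm_eq {n : Type*} [Fintype n] [DecidableEq n] {ρ W : Matrix n n ℂ} {p : n → ℝ}
    (hρ : ρ = W * diagonal (fun i => (p i : ℂ)) * Wᴴ) (hpos : ρ.PosSemidef) (hW : W * Wᴴ = 1)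
    (s : ℝ) (Y : Matrix n n ℂ) :
    cohForm s Y ρ = ∑ k, ∑ i, (2 * (p i * (star ((Y * W) k i) * W k i).re)
      - ((ρ k k).re + s * p i) * ‖(Y * W) k i‖ ^ 2) := by
  have h1 : (Yᴴ * ρ).trace = ((Y * W)ᴴ * (W * diagonal (fun i => (p i : ℂ)))).trace := by
    rw [hρ, conjTranspose_mul, Matrix.mul_assoc Wᴴ, trace_mul_comm Wᴴ]
    simp only [Matrix.mul_assoc]
  have h2 : (Yᴴ * deph ρ * Y).trace = ((Y * W)ᴴ * (deph ρ * (Y * W))).trace := by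
    rw [conjTranspose_mul, Matrix.mul_assoc Wᴴ, trace_mul_comm Wᴴ]
    simp only [Matrix.mul_assoc, hW, Matrix.mul_one]
  have h3 : (Y * ρ * Yᴴ).trace =
      ((Y * W)ᴴ * ((Y * W) * diagonal (fun i => (p i : ℂ)))).trace := by
    rw [hρ, trace_mul_comm (Y * W)ᴴ, conjTranspose_mul]
    simp only [Matrix.mul_assoc]
  have hd : deph ρ = diagonal fun k => ((ρ k k).re : ℂ) := by
    simp only [deph, hpos.coe_re_diag]
  rw [cohForm, h1, h2, h3, hd]
  generalize Y * W = Z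
  have key : ∀ B : Matrix n n ℂ, (Zᴴ * B).trace.re = ∑ k, ∑ i, (star (Z k i) * B k i).re := by
    intro B
    simp only [trace, diag_apply, Matrix.mul_apply, conjTranspose_apply, Complex.re_sum]
    exact Finset.sum_comm
  rw [key, key, key]
  simp only [Finset.mul_sum, ← Finset.sum_sub_distrib]
  refine Finset.sum_congr rfl fun k _ => Finset.sum_congr rfl fun i _ => ?_
  rw [mul_diagonal, mul_diagonal, diagonal_mul, ← Complex.normSq_eq_norm_sq, Complex.normSq_apply]
  simp
  ring

theorem cohForm_le_logProfileDeriv {n : Type*} [Fintype n] [DecidableEq n]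
    {ρ W : Matrix n n ℂ} {p : n → ℝ} (hρ : ρ = W * diagonal (fun i => (p i : ℂ)) * Wᴴ)
    (hpos : ρ.PosSemidef) (hW : W * Wᴴ = 1) (hp : ∀ i, 0 ≤ p i) {s : ℝ} (hs : 0 < s)
    (Y : Matrix n n ℂ) :
    cohForm s Y ρ ≤ logProfileDeriv W p (fun k => (ρ k k).re) s := by
  rw [cohForm_eq hρ hpos hW]
  refine Finset.sum_le_sum fun k _ => Finset.sum_le_sum fun i _ => ?_
  have hq : 0 ≤ (ρ k k).re := (Complex.le_def.1 (hpos.diag_nonneg (i := k))).1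
  rcases (hp i).eq_or_lt with h | h
  · simpa [← h] using mul_nonneg hq (sq_nonneg ‖(Y * W) k i‖)
  · have h0 : 0 < (ρ k k).re + s * p i := add_pos_of_nonneg_of_pos hq (mul_pos hs h)
    have hre : (star ((Y * W) k i) * W k i).re ≤ ‖(Y * W) k i‖ * ‖W k i‖ := by
      refine (Complex.re_le_norm _).trans (by simp)
    set c := (ρ k k).re + s * p i
    have hsq : ‖W k i‖ ^ 2 * (p i ^ 2 / c)
        - (2 * (p i * (‖(Y * W) k i‖ * ‖W k i‖)) - c * ‖(Y * W) k i‖ ^ 2)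
        = (c * ‖(Y * W) k i‖ - p i * ‖W k i‖) ^ 2 / c := by
      field_simp
      ring
    have hnn := div_nonneg (sq_nonneg (c * ‖(Y * W) k i‖ - p i * ‖W k i‖)) h0.le
    have := mul_le_mul_of_nonneg_left hre h.le
    linarith

theorem exists_cohForm_eq_logProfileDeriv {n : Type*} [Fintype n] [DecidableEq n]
    {ρ W : Matrix n n ℂ} {p : n → ℝ} (hρ : ρ = W * diagonal (fun i => (p i : ℂ)) * Wᴴ)
    (hpos : ρ.PosSemidef) (hW : W * Wᴴ = 1) (hp : ∀ i, 0 ≤ p i) {s : ℝ} (hs : 0 < s) :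
    ∃ Y, cohForm s Y ρ = logProfileDeriv W p (fun k => (ρ k k).re) s := by
  let Z : Matrix n n ℂ := of fun k i => ((p i / ((ρ k k).re + s * p i) : ℝ) : ℂ) * W k i
  refine ⟨Z * Wᴴ, ?_⟩
  rw [cohForm_eq hρ hpos hW, Matrix.mul_assoc, mul_eq_one_comm.1 hW, Matrix.mul_one]
  refine Finset.sum_congr rfl fun k _ => Finset.sum_congr rfl fun i _ => ?_
  have hq : 0 ≤ (ρ k k).re := (Complex.le_def.1 (hpos.diag_nonneg (i := k))).1
  rcases (hp i).eq_or_lt with h | h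
  · simp [Z, ← h]
  · have h0 : 0 < (ρ k k).re + s * p i := add_pos_of_nonneg_of_pos hq (mul_pos hs h)
    simp only [Z, of_apply]
    set c := (ρ k k).re + s * p i
    simp only [← Complex.normSq_eq_norm_sq, Complex.normSq_apply]
    simp only [Complex.star_def, map_mul, Complex.conj_ofReal, Complex.mul_re, Complex.mul_im,
      Complex.ofReal_re, Complex.ofReal_im, Complex.conj_re, Complex.conj_im]
    field_simp
    ring

theorem Matrix.PosSemidef.exists_unitary_diagonalization {n : Type*} [Fintype n] [DecidableEq n]
    {ρ : Matrix n n ℂ} (hρ : ρ.PosSemidef) :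
    ∃ (W : Matrix n n ℂ) (p : n → ℝ), ρ = W * diagonal (fun i => (p i : ℂ)) * Wᴴ ∧
      W * Wᴴ = 1 ∧ (∀ i, 0 ≤ p i) ∧ vN ρ = ∑ i, Real.negMulLog (p i) := by
  refine ⟨hρ.isHermitian.eigenvectorUnitary, hρ.isHermitian.eigenvalues, ?_, ?_,
    hρ.eigenvalues_nonneg, ?_⟩
  · exact hρ.isHermitian.spectral_theorem
  · exact Unitary.coe_mul_star_self _
  · rw [vN, dif_pos hρ.isHermitian]

theorem re_diag_eq_sum {n : Type*} [Fintype n] [DecidableEq n] {ρ W : Matrix n n ℂ} {p : n → ℝ}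
    (hρ : ρ = W * diagonal (fun i => (p i : ℂ)) * Wᴴ) (k : n) :
    (ρ k k).re = ∑ i, ‖W k i‖ ^ 2 * p i := by
  rw [hρ, Matrix.mul_apply, Complex.re_sum]
  refine Finset.sum_congr rfl fun i _ => ?_
  rw [mul_diagonal, conjTranspose_apply, ← Complex.normSq_eq_norm_sq, Complex.normSq_apply]
  simp
  ring

theorem sum_norm_sq_column {n : Type*} [Fintype n] [DecidableEq n] {W : Matrix n n ℂ}
    (hW : Wᴴ * W = 1) (i : n) : ∑ k, ‖W k i‖ ^ 2 = 1 := by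
  have := congrArg Complex.re (congrFun (congrFun hW i) i)
  rw [Matrix.mul_apply, Complex.re_sum, one_apply_eq, Complex.one_re] at this
  rw [← this]
  refine Finset.sum_congr rfl fun k _ => ?_
  rw [conjTranspose_apply, ← Complex.normSq_eq_norm_sq, Complex.normSq_apply]
  simp

/-- The relative entropy of coherence, extended homogeneously to positive semidefinite matrices,
is subadditive. -/
theorem coh_sum_le {n ι : Type*} [Fintype n] [DecidableEq n] [Fintype ι] {τ : ι → Matrix n n ℂ}
    (hτ : ∀ a, (τ a).PosSemidef) : coh (∑ a, τ a) ≤ ∑ a, coh (τ a) := by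
  have hσ : (∑ a, τ a).PosSemidef := posSemidef_sum _ fun a _ => hτ a
  choose W p hdec hW hp hvN using fun a => (hτ a).exists_unitary_diagonalization
  obtain ⟨W₀, p₀, hdec₀, hW₀, hp₀, hvN₀⟩ := hσ.exists_unitary_diagonalization
  have nonneg {ρ : Matrix n n ℂ} (h : ρ.PosSemidef) (k : n) : 0 ≤ (ρ k k).re :=
    (Complex.le_def.1 (h.diag_nonneg (i := k))).1
  have le_diag {ρ W : Matrix n n ℂ} {p : n → ℝ}
      (h : ρ = W * diagonal (fun i => (p i : ℂ)) * Wᴴ) (hp : ∀ i, 0 ≤ p i) (k i : n) :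
      ‖W k i‖ ^ 2 * p i ≤ (ρ k k).re := by
    rw [re_diag_eq_sum h]
    exact Finset.single_le_sum (f := fun i => ‖W k i‖ ^ 2 * p i)
      (fun j _ => mul_nonneg (sq_nonneg _) (hp j)) (Finset.mem_univ i)
  have at_zero {ρ W : Matrix n n ℂ} {p : n → ℝ} (hpos : ρ.PosSemidef)
      (h : ρ = W * diagonal (fun i => (p i : ℂ)) * Wᴴ) :
      logProfile W p (fun k => (ρ k k).re) 0 = -vN (deph ρ) := by
    rw [vN_deph hpos, ← Finset.sum_neg_distrib]
    refine Finset.sum_congr rfl fun k _ => ?_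
    simp only [zero_mul, add_zero, ← mul_assoc, ← Finset.sum_mul, ← re_diag_eq_sum h k,
      Real.negMulLog]
    ring
  have at_top {ρ W : Matrix n n ℂ} {p : n → ℝ} (hpos : ρ.PosSemidef)
      (h : ρ = W * diagonal (fun i => (p i : ℂ)) * Wᴴ) (hW : W * Wᴴ = 1) (hp : ∀ i, 0 ≤ p i)
      (hvN : vN ρ = ∑ i, Real.negMulLog (p i)) :
      Filter.Tendsto (fun t => logProfile W p (fun k => (ρ k k).re) t
        - (∑ k, (ρ k k).re) * Real.log t) Filter.atTop (nhds (-vN ρ)) := by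
    have := tendsto_logProfile W hp (nonneg hpos)
    simp only [← re_diag_eq_sum h] at this
    convert this using 2
    rw [Finset.sum_comm, hvN, ← Finset.sum_neg_distrib]
    refine Finset.sum_congr rfl fun i _ => ?_
    rw [← Finset.sum_mul, sum_norm_sq_column (mul_eq_one_comm.1 hW), Real.negMulLog]
    ring
  let Ψ : ℝ → ℝ := fun t => ∑ a, logProfile (W a) (p a) (fun k => (τ a k k).re) t
    - logProfile W₀ p₀ (fun k => ((∑ a, τ a) k k).re) t
  have hcont : ContinuousOn Ψ (Set.Ici 0) :=
    (continuousOn_finsetSum _ fun a _ =>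
      continuousOn_logProfile (hp a) (le_diag (hdec a) (hp a))).sub
      (continuousOn_logProfile hp₀ (le_diag hdec₀ hp₀))
  have hderiv (t : ℝ) (ht : 0 < t) : HasDerivAt Ψ
      (∑ a, logProfileDeriv (W a) (p a) (fun k => (τ a k k).re) t
        - logProfileDeriv W₀ p₀ (fun k => ((∑ a, τ a) k k).re) t) t :=
    (HasDerivAt.fun_sum fun a _ => hasDerivAt_logProfile (W a) (hp a) (nonneg (hτ a)) ht).sub
      (hasDerivAt_logProfile W₀ hp₀ (nonneg hσ) ht)
  have hmono : MonotoneOn Ψ (Set.Ici 0) := by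
    refine monotoneOn_of_deriv_nonneg (convex_Ici 0) hcont ?_ ?_
    · rw [interior_Ici]
      exact fun t ht => (hderiv t ht).differentiableAt.differentiableWithinAt
    · rw [interior_Ici]
      intro t ht
      obtain ⟨Y, hY⟩ := exists_cohForm_eq_logProfileDeriv hdec₀ hσ hW₀ hp₀ ht
      rw [(hderiv t ht).deriv, ← hY, cohForm_sum, sub_nonneg]
      exact Finset.sum_le_sum fun a _ =>
        cohForm_le_logProfileDeriv (hdec a) (hτ a) (hW a) (hp a) ht Y
  have hlim : Filter.Tendsto Ψ Filter.atTop (nhds (∑ a, -vN (τ a) - -vN (∑ a, τ a))) := by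
    refine ((tendsto_finsetSum Finset.univ fun a _ =>
      at_top (hτ a) (hdec a) (hW a) (hp a) (hvN a)).sub
      (at_top hσ hdec₀ hW₀ hp₀ hvN₀)).congr fun t => ?_
    have htr : ∑ k, ((∑ a, τ a) k k).re = ∑ a, ∑ k, (τ a k k).re := by
      simp only [Matrix.sum_apply, Complex.re_sum]
      exact Finset.sum_comm
    simp only [Ψ, Finset.sum_sub_distrib, ← Finset.sum_mul, htr]
    ring
  have hle : Ψ 0 ≤ ∑ a, -vN (τ a) - -vN (∑ a, τ a) := by
    refine ge_of_tendsto hlim ?_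
    filter_upwards [Filter.eventually_ge_atTop 0] with t ht
    exact hmono Set.self_mem_Ici ht ht
  simp only [Ψ, at_zero hσ hdec₀, fun a => at_zero (hτ a) (hdec a), Finset.sum_neg_distrib] at hle
  simp only [coh, Finset.sum_sub_distrib]
  linarith

/-! ### Bipartite states -/

/-- The diagonal `B`-block of a bipartite matrix at the index `a` of `A`. -/
def blockAt {nA nB : Type*} (M : Matrix (nA × nB) (nA × nB) ℂ) (a : nA) : Matrix nB nB ℂ :=
  M.submatrix (Prod.mk a) (Prod.mk a)

section Bipartite

variable {nA nB : Type*} [Fintype nA] [DecidableEq nA] [Fintype nB] [DecidableEq nB]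

theorem dephA_eq_reindex_blockDiagonal (M : Matrix (nA × nB) (nA × nB) ℂ) :
    dephA M = reindex (Equiv.prodComm nB nA) (Equiv.prodComm nB nA)
      (blockDiagonal (blockAt M)) := by
  ext ⟨a, b⟩ ⟨a', b'⟩
  by_cases h : a = a'
  · subst h
    simp [dephA, blockAt, blockDiagonal_apply]
  · simp [dephA, blockDiagonal_apply, h]

theorem posSemidef_dephA {M : Matrix (nA × nB) (nA × nB) ℂ} (hM : M.PosSemidef) :
    (dephA M).PosSemidef := by
  let D : nA → Matrix (nA × nB) (nA × nB) ℂ := fun a =>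
    diagonal fun x => if x.1 = a then 1 else 0
  have h : dephA M = ∑ a, D a * M * (D a)ᴴ := by
    ext ⟨a, b⟩ ⟨a', b'⟩
    simp [dephA, D, Matrix.sum_apply, diagonal_conjTranspose, apply_ite star, eq_comm]
  rw [h]
  exact posSemidef_sum _ fun a _ => hM.mul_mul_conjTranspose_same _

theorem posSemidef_redA {M : Matrix (nA × nB) (nA × nB) ℂ} (hM : M.PosSemidef) :
    (redA M).PosSemidef := by
  have h : redA M = ∑ b, M.submatrix (fun a => (a, b)) (fun a => (a, b)) := by
    ext a a'
    simp [redA, Matrix.sum_apply]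
  rw [h]
  exact posSemidef_sum _ fun b _ => hM.submatrix _

theorem redB_eq_sum_blockAt (M : Matrix (nA × nB) (nA × nB) ℂ) :
    redB M = ∑ a, blockAt M a := by
  ext b b'
  simp [redB, blockAt, Matrix.sum_apply]

theorem posSemidef_redB {M : Matrix (nA × nB) (nA × nB) ℂ} (hM : M.PosSemidef) :
    (redB M).PosSemidef := by
  rw [redB_eq_sum_blockAt]
  exact posSemidef_sum _ fun a _ => hM.submatrix _

theorem trace_dephA (M : Matrix (nA × nB) (nA × nB) ℂ) : (dephA M).trace = M.trace := by
  simp [trace, dephA]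

theorem vN_dephA {M : Matrix (nA × nB) (nA × nB) ℂ} (hM : M.PosSemidef) :
    vN (dephA M) = ∑ a, vN (blockAt M a) := by
  have hne : ∏ a, (blockAt M a).charpoly ≠ 0 :=
    Finset.prod_ne_zero_iff.2 fun a _ => (charpoly_monic _).ne_zero
  rw [vN_eq_sum_roots (posSemidef_dephA hM).isHermitian, dephA_eq_reindex_blockDiagonal,
    charpoly_reindex, charpoly_blockDiagonal, Polynomial.roots_prod _ _ hne, Multiset.map_bind,
    Multiset.sum_bind]
  exact Finset.sum_congr rfl fun a _ => (vN_eq_sum_roots (hM.isHermitian.submatrix _)).symm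

theorem mi_le_card {M : Matrix (nA × nB) (nA × nB) ℂ} (hM : M.PosSemidef) (htr : M.trace = 1) :
    mi M ≤ Fintype.card nA + Fintype.card nB := by
  have := vN_le_card (posSemidef_redA hM)
  have := vN_le_card (posSemidef_redB hM)
  have := vN_nonneg hM htr
  unfold mi
  linarith

/-- Rotating and then dephasing the `B` side of a state dephased on `A` does not increase the mutual
information. -/
theorem mi_deph_le_mi_dephA {M : Matrix (nA × nB) (nA × nB) ℂ} (hM : M.PosSemidef)
    {V : Matrix nB nB ℂ} (hV : Vᴴ * V = 1) :
    mi (deph (((1 : Matrix nA nA ℂ) ⊗ₖ V) * M * ((1 : Matrix nA nA ℂ) ⊗ₖ V)ᴴ)) ≤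
      mi (dephA M) := by
  set R := ((1 : Matrix nA nA ℂ) ⊗ₖ V) * M * ((1 : Matrix nA nA ℂ) ⊗ₖ V)ᴴ with hRdef
  have hR : R.PosSemidef := hM.mul_mul_conjTranspose_same _
  have hblock (a : nA) : blockAt R a = V * blockAt M a * Vᴴ := by
    ext b b'
    simp [hRdef, blockAt, Matrix.mul_apply, Fintype.sum_prod_type, one_apply, ite_mul,
      apply_ite star, Finset.sum_ite_irrel]
  have hMblock (a : nA) : (blockAt M a).PosSemidef := hM.submatrix _
  have hRblock (a : nA) : (blockAt R a).PosSemidef := hR.submatrix _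
  have hsum : redB R = V * redB M * Vᴴ := by
    simp only [redB_eq_sum_blockAt, hblock, Matrix.mul_sum, Matrix.sum_mul]
  have hA : redA (deph R) = redA (dephA M) := by
    ext a a'
    by_cases h : a = a'
    · subst h
      have ht : (blockAt R a).trace = (blockAt M a).trace := by
        rw [hblock, Matrix.mul_assoc, trace_mul_comm, Matrix.mul_assoc, hV, Matrix.mul_one]
      simpa [redA, deph, dephA, blockAt, trace] using ht
    · simp [redA, deph, dephA, h]
  have hB : redB (deph R) = deph (redB R) := by
    ext b b'
    by_cases h : b = b' <;> simp [redB, deph, h]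
  have hB' : redB (dephA M) = redB M := by
    ext b b'
    simp [redB, dephA]
  have hdeph : vN (deph R) = ∑ a, vN (deph (blockAt R a)) := by
    simp only [vN_deph hR, vN_deph (hRblock _), Fintype.sum_prod_type]
    rfl
  have hcoh := coh_sum_le hRblock
  rw [← redB_eq_sum_blockAt] at hcoh
  simp only [coh, Finset.sum_sub_distrib] at hcoh
  have hvR : vN (redB R) = vN (redB M) := by
    rw [hsum, vN_unitary_conj (posSemidef_redB hM).isHermitian hV]
  have hvblock (a : nA) : vN (blockAt R a) = vN (blockAt M a) := by
    rw [hblock, vN_unitary_conj (hMblock a).isHermitian hV]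
  simp only [hvblock, hvR] at hcoh
  simp only [mi, hA, hB, hB', hdeph, vN_dephA hM]
  linarith

end Bipartite

/-- The one-sided (Zurek) discord is bounded above by the symmetric discord:
`Θ^{A|B}(ρ) ≤ Θ(ρ)`. -/
theorem one_sided_discord_le_symmetric_discord
    {nA nB : Type*} [Fintype nA] [DecidableEq nA] [Nonempty nA]
    [Fintype nB] [DecidableEq nB] [Nonempty nB]
    (ρ : Matrix (nA × nB) (nA × nB) ℂ) (hρ : ρ.PosSemidef) (htr : ρ.trace = 1) :
    (⨅ U : Matrix.unitaryGroup nA ℂ, (mi ρ - mi (dephA (conjA (U : Matrix nA nA ℂ) ρ))))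
      ≤ ⨅ UV : Matrix.unitaryGroup nA ℂ × Matrix.unitaryGroup nB ℂ,
          (mi ρ - mi (deph (((UV.1 : Matrix nA nA ℂ) ⊗ₖ (UV.2 : Matrix nB nB ℂ)) * ρ *
            ((UV.1 : Matrix nA nA ℂ) ⊗ₖ (UV.2 : Matrix nB nB ℂ))ᴴ))) := by
  have hpos (U : Matrix nA nA ℂ) : (conjA (nB := nB) U ρ).PosSemidef :=
    hρ.mul_mul_conjTranspose_same _
  have hbdd : BddBelow (Set.range fun U : Matrix.unitaryGroup nA ℂ =>
      mi ρ - mi (dephA (conjA (U : Matrix nA nA ℂ) ρ))) := by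
    refine ⟨mi ρ - (Fintype.card nA + Fintype.card nB), ?_⟩
    rintro _ ⟨U, rfl⟩
    refine sub_le_sub_left (mi_le_card (posSemidef_dephA (hpos _)) ?_) _
    have hU : (U : Matrix nA nA ℂ)ᴴ * U = 1 := Unitary.coe_star_mul_self U
    rw [trace_dephA, conjA, trace_mul_comm, ← Matrix.mul_assoc, conjTranspose_kronecker,
      ← mul_kronecker_mul, hU, conjTranspose_one, Matrix.one_mul, one_kronecker_one,
      Matrix.one_mul, htr]
  refine le_ciInf fun UV => (ciInf_le hbdd UV.1).trans (sub_le_sub_left ?_ _)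
  have hUV : ((UV.1 : Matrix nA nA ℂ) ⊗ₖ (UV.2 : Matrix nB nB ℂ)) =
      ((1 : Matrix nA nA ℂ) ⊗ₖ (UV.2 : Matrix nB nB ℂ)) *
        ((UV.1 : Matrix nA nA ℂ) ⊗ₖ (1 : Matrix nB nB ℂ)) := by
    rw [← mul_kronecker_mul, Matrix.one_mul, Matrix.mul_one]
  have h := mi_deph_le_mi_dephA (hpos UV.1) (V := (UV.2 : Matrix nB nB ℂ))
    (Unitary.coe_star_mul_self UV.2)
  rw [hUV, conjTranspose_mul]
  simpa only [conjA, Matrix.mul_assoc] using h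
end

section
/- (Theorem 4, second inequality) Let ρ be an N-partite density matrix. Then the symmetric multipartite discord and the local coherences together bound the total coherence from below: Θ(ρ) + ∑_{i=1}^{N} C(ρ^i) ≤ C(ρ). -/
open Matrix
open Kronecker
open scoped ComplexOrder

/-- The tensor product `⊗U` of a family of local unitaries, as a matrix on the
product index type. -/
noncomputable def locU {N : ℕ} {n : Fin N → Type*} [∀ i, Fintype (n i)]
    [∀ i, DecidableEq (n i)] (U : ∀ i, Matrix.unitaryGroup (n i) ℂ) :
    Matrix (∀ i, n i) (∀ i, n i) ℂ :=
  Matrix.of fun k k' => ∏ i, (U i : Matrix (n i) (n i) ℂ) (k i) (k' i)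

/-- The reduced density matrix of an `N`-partite state on subsystem `i`
(partial trace over all other subsystems). -/
noncomputable def red1 {N : ℕ} {n : Fin N → Type*} [∀ i, Fintype (n i)]
    [∀ i, DecidableEq (n i)] (ρ : Matrix (∀ i, n i) (∀ i, n i) ℂ) (i : Fin N) :
    Matrix (n i) (n i) ℂ :=
  Matrix.of fun x x' => ∑ k : ∀ j : {j : Fin N // j ≠ i}, n j,
    ρ (fun j => if h : j = i then h.symm ▸ x else k ⟨j, h⟩)
      (fun j => if h : j = i then h.symm ▸ x' else k ⟨j, h⟩)

/-- Multipartite quantum mutual information (total correlation). -/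
noncomputable def miN {N : ℕ} {n : Fin N → Type*} [∀ i, Fintype (n i)]
    [∀ i, DecidableEq (n i)] (ρ : Matrix (∀ i, n i) (∀ i, n i) ℂ) : ℝ :=
  (∑ i, vN (red1 ρ i)) - vN ρ

theorem negMulLog_le_one {x : ℝ} (hx : 0 ≤ x) : Real.negMulLog x ≤ 1 := by
  rcases hx.eq_or_lt with rfl | hpos
  · simp
  · have h := mul_le_mul_of_nonneg_left (Real.one_sub_inv_le_log_of_pos hpos) hx
    rw [mul_sub, mul_inv_cancel₀ hpos.ne'] at h
    rw [Real.negMulLog]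
    linarith

section Entropy

variable {n : Type*} [Fintype n] [DecidableEq n] {ρ : Matrix n n ℂ}

theorem vN_eq_sum (h : ρ.IsHermitian) : vN ρ = ∑ i, Real.negMulLog (h.eigenvalues i) := by
  simp [vN, h]

theorem vN_le_card_s13 (h : ρ.PosSemidef) : vN ρ ≤ Fintype.card n := by
  rw [vN_eq_sum h.isHermitian]
  calc ∑ i, Real.negMulLog (h.isHermitian.eigenvalues i) ≤ ∑ _i : n, (1 : ℝ) :=
        Finset.sum_le_sum fun i _ => negMulLog_le_one (h.eigenvalues_nonneg i)
    _ = Fintype.card n := by simp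

theorem vN_nonneg_s13 (h : ρ.PosSemidef) (htr : ρ.trace = 1) : 0 ≤ vN ρ := by
  have hsum : ∑ i, h.isHermitian.eigenvalues i = 1 := by
    have := h.isHermitian.trace_eq_sum_eigenvalues
    rw [htr] at this
    exact Complex.ofReal_injective (by simpa using this.symm)
  rw [vN_eq_sum h.isHermitian]
  refine Finset.sum_nonneg fun i _ => Real.negMulLog_nonneg (h.eigenvalues_nonneg i) ?_
  rw [← hsum]
  exact Finset.single_le_sum (fun j _ => h.eigenvalues_nonneg j) (Finset.mem_univ i)

theorem posSemidef_deph (h : ρ.PosSemidef) : (deph ρ).PosSemidef :=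
  PosSemidef.diagonal fun _ => h.diag_nonneg

theorem trace_deph (ρ : Matrix n n ℂ) : (deph ρ).trace = ρ.trace := by
  simp [deph, Matrix.trace]

end Entropy

section Multipartite

variable {N : ℕ} {n : Fin N → Type*} [∀ i, Fintype (n i)] [∀ i, DecidableEq (n i)]

theorem locU_one : locU (1 : ∀ i, Matrix.unitaryGroup (n i) ℂ) = 1 := by
  ext k k'
  simp only [locU, Matrix.of_apply, Pi.one_apply, OneMemClass.coe_one, Matrix.one_apply,
    Finset.prod_ite_zero, Finset.prod_const_one, Finset.mem_univ, true_imp_iff, funext_iff]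

theorem conjTranspose_locU_mul_locU (U : ∀ i, Matrix.unitaryGroup (n i) ℂ) :
    (locU U)ᴴ * locU U = 1 := by
  rw [← locU_one]
  ext k k'
  simp only [locU, Matrix.mul_apply, Matrix.conjTranspose_apply, Matrix.of_apply, star_prod,
    ← Finset.prod_mul_distrib]
  rw [← Fintype.prod_sum fun i x => star ((U i : Matrix (n i) (n i) ℂ) x (k i)) *
    (U i : Matrix (n i) (n i) ℂ) x (k' i)]
  refine Finset.prod_congr rfl fun i _ => ?_
  have h := congrFun (congrFun (Matrix.UnitaryGroup.star_mul_self (U i)) (k i)) (k' i)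
  simpa [Matrix.mul_apply, Matrix.star_apply] using h

theorem red1_deph (ρ : Matrix (∀ i, n i) (∀ i, n i) ℂ) (i : Fin N) :
    red1 (deph ρ) i = deph (red1 ρ i) := by
  ext x x'
  by_cases hx : x = x'
  · subst hx
    simp [red1, deph]
  · simp only [red1, deph, Matrix.of_apply, Matrix.diagonal_apply_ne _ hx]
    refine Finset.sum_eq_zero fun k _ => Matrix.diagonal_apply_ne _ fun h => hx ?_
    simpa using congrFun h i

theorem posSemidef_red1_deph {ρ : Matrix (∀ i, n i) (∀ i, n i) ℂ} (h : ρ.PosSemidef)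
    (i : Fin N) : (red1 (deph ρ) i).PosSemidef := by
  rw [red1_deph]
  exact PosSemidef.diagonal fun _ => Finset.sum_nonneg fun _ _ => h.diag_nonneg

theorem miN_deph_le {ρ : Matrix (∀ i, n i) (∀ i, n i) ℂ} (h : ρ.PosSemidef)
    (htr : ρ.trace = 1) : miN (deph ρ) ≤ ∑ i, (Fintype.card (n i) : ℝ) := by
  have h₁ := vN_nonneg_s13 (posSemidef_deph h) ((trace_deph ρ).trans htr)
  have h₂ : ∑ i, vN (red1 (deph ρ) i) ≤ ∑ i, (Fintype.card (n i) : ℝ) :=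
    Finset.sum_le_sum fun i _ => vN_le_card_s13 (posSemidef_red1_deph h i)
  rw [miN]
  linarith

theorem miN_sub_miN_deph_add_sum_coh (ρ : Matrix (∀ i, n i) (∀ i, n i) ℂ) :
    miN ρ - miN (deph ρ) + ∑ i, coh (red1 ρ i) = coh ρ := by
  simp only [miN, coh, red1_deph, Finset.sum_sub_distrib]
  ring

theorem bddBelow_range_miN_sub_miN_deph {ρ : Matrix (∀ i, n i) (∀ i, n i) ℂ}
    (hρ : ρ.PosSemidef) (htr : ρ.trace = 1) :
    BddBelow (Set.range fun U : ∀ i, Matrix.unitaryGroup (n i) ℂ =>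
      miN ρ - miN (deph (locU U * ρ * (locU U)ᴴ))) := by
  refine ⟨miN ρ - ∑ i, (Fintype.card (n i) : ℝ), ?_⟩
  rintro _ ⟨U, rfl⟩
  refine sub_le_sub_left (miN_deph_le (hρ.mul_mul_conjTranspose_same _) ?_) _
  rw [Matrix.trace_mul_comm, ← Matrix.mul_assoc, conjTranspose_locU_mul_locU, Matrix.one_mul, htr]

end Multipartite

/-- Theorem 4 (second inequality): `Θ(ρ) + ∑ i, C(ρ^i) ≤ C(ρ)` for the
symmetric multipartite discord `Θ`. -/
theorem symmetric_multipartite_discord_add_local_coherences_le_coherence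
    {N : ℕ} {n : Fin N → Type*} [∀ i, Fintype (n i)] [∀ i, DecidableEq (n i)]
    [∀ i, Nonempty (n i)]
    (ρ : Matrix (∀ i, n i) (∀ i, n i) ℂ) (hρ : ρ.PosSemidef) (htr : ρ.trace = 1) :
    (⨅ U : ∀ i, Matrix.unitaryGroup (n i) ℂ,
        (miN ρ - miN (deph (locU U * ρ * (locU U)ᴴ))))
      + ∑ i, coh (red1 ρ i) ≤ coh ρ := by
  rw [← miN_sub_miN_deph_add_sum_coh ρ]
  gcongr
  refine (ciInf_le (bddBelow_range_miN_sub_miN_deph hρ htr) 1).trans_eq ?_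
  simp [locU_one]
end
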